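/- Suppose no nontrivial transverse Jacobi solution vanishes at any t ∈ (0,a]. Then for every piecewise-C¹ curve X : [0,a] → ℝ^n with X(0) ∈ V₀ there exists a unique transverse Jacobi solution J with J(a) = X(a), and I(X,X) ≥ I(J,J), with equality if and only if X = J. -/

import Mathlib

open scoped RealInnerProductSpace
open MeasureTheory

/-- A transverse Jacobi solution on `[0, a]`: a `C²` curve `J` (with derivative `J'`)
satisfying `J'' + R(t) J = 0`, `J(0) ∈ V₀`, and `⟨J'(0), w⟩ = −h(J(0), w)` for all `w ∈ V₀`. -/
structure TransverseJacobi (n : ℕ) (a : ℝ)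
    (R : ℝ → EuclideanSpace ℝ (Fin n) →L[ℝ] EuclideanSpace ℝ (Fin n))
    (V₀ : Submodule ℝ (EuclideanSpace ℝ (Fin n)))
    (h : EuclideanSpace ℝ (Fin n) →ₗ[ℝ] EuclideanSpace ℝ (Fin n) →ₗ[ℝ] ℝ) where
  J : ℝ → EuclideanSpace ℝ (Fin n)
  J' : ℝ → EuclideanSpace ℝ (Fin n)
  hasDeriv : ∀ t ∈ Set.Icc 0 a, HasDerivWithinAt J (J' t) (Set.Icc 0 a) t
  hasDeriv' : ∀ t ∈ Set.Icc 0 a, HasDerivWithinAt J' (-(R t (J t))) (Set.Icc 0 a) t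
  init_mem : J 0 ∈ V₀
  init_deriv : ∀ w ∈ V₀, ⟪J' 0, w⟫ = - h (J 0) w

/-- The index form
`I(X, Y) := −h(X(0), Y(0)) + ∫₀ᵃ (⟨X'(t), Y'(t)⟩ − ⟨R(t) X(t), Y(t)⟩) dt`. -/
noncomputable def indexForm (n : ℕ) (a : ℝ)
    (R : ℝ → EuclideanSpace ℝ (Fin n) →L[ℝ] EuclideanSpace ℝ (Fin n))
    (h : EuclideanSpace ℝ (Fin n) →ₗ[ℝ] EuclideanSpace ℝ (Fin n) →ₗ[ℝ] ℝ)
    (X X' Y Y' : ℝ → EuclideanSpace ℝ (Fin n)) : ℝ :=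
  - h (X 0) (Y 0) + ∫ t in (0:ℝ)..a, (⟪X' t, Y' t⟫ - ⟪R t (X t), Y t⟫)

theorem exists_hasDerivAt_clm_of_continuous {E : Type*} [NormedAddCommGroup E] [NormedSpace ℝ E]
    [CompleteSpace E] {A : ℝ → E →L[ℝ] E} (hA : Continuous A) {M : ℝ} (hM : ∀ t, ‖A t‖ ≤ M)
    (x₀ : E) : ∃ x : ℝ → E, x 0 = x₀ ∧ ∀ t, HasDerivAt x (A t (x t)) t := by
  have hM0 : 0 ≤ M := (norm_nonneg _).trans (hM 0)
  let u : ℕ → ℝ → E := fun k => Nat.rec (fun _ => x₀) (fun _ v t => ∫ s in (0 : ℝ)..t, A s (v s)) k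
  have hu_succ : ∀ k t, u (k + 1) t = ∫ s in (0 : ℝ)..t, A s (u k s) := fun _ _ => rfl
  have hu_cont : ∀ k, Continuous (u k) := by
    intro k
    induction k with
    | zero => exact continuous_const
    | succ k ih =>
      exact intervalIntegral.continuous_primitive
        (fun _ _ => (hA.clm_apply ih).intervalIntegrable _ _) 0
  have hu_deriv : ∀ k t, HasDerivAt (u (k + 1)) (A t (u k t)) t := fun k t =>
    ((hA.clm_apply (hu_cont k)).integral_hasStrictDerivAt 0 t).hasDerivAt
  have hu_bound : ∀ k t, ‖u k t‖ ≤ ‖x₀‖ * (M * |t|) ^ k / k.factorial := by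
    intro k
    induction k with
    | zero => intro t; simp [u]
    | succ k ih =>
      intro t
      rw [hu_succ]
      refine intervalIntegral.norm_integral_le_integral_norm_uIoc.trans ?_
      calc ∫ s in Set.uIoc 0 t, ‖A s (u k s)‖
          ≤ ∫ s in Set.uIoc 0 t, ‖x₀‖ * M ^ (k + 1) / k.factorial * |s - 0| ^ k := by
            refine setIntegral_mono_on
              (hA.clm_apply (hu_cont k)).norm.integrableOn_uIoc
              (by fun_prop : Continuous fun s : ℝ =>
                ‖x₀‖ * M ^ (k + 1) / k.factorial * |s - 0| ^ k).integrableOn_uIoc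
              measurableSet_uIoc fun s _ => ?_
            calc ‖A s (u k s)‖ ≤ M * (‖x₀‖ * (M * |s|) ^ k / k.factorial) :=
                  (A s).le_of_opNorm_le_of_le (hM s) (ih s)
              _ = _ := by rw [sub_zero]; ring
        _ = ‖x₀‖ * (M * |t|) ^ (k + 1) / (k + 1).factorial := by
            rw [MeasureTheory.integral_const_mul, integral_pow_abs_sub_uIoc, sub_zero,
              Nat.factorial_succ]
            push_cast
            field_simp
            ring
  refine ⟨fun t => ∑' k, u k t, ?_, fun t => ?_⟩
  · refine (tsum_eq_single 0 ?_).trans rfl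
    intro k hk
    obtain ⟨k, rfl⟩ := Nat.exists_eq_succ_of_ne_zero hk
    simp [hu_succ]
  · set b : ℝ := |t| + 1
    have hb : ∀ s ∈ Metric.ball (0 : ℝ) b, ∀ k, ‖u k s‖ ≤ ‖x₀‖ * ((M * b) ^ k / k.factorial) := by
      intro s hs k
      have hs' : |s| ≤ b := by simpa using (Metric.mem_ball.1 hs).le
      refine (hu_bound k s).trans ?_
      rw [mul_div_assoc]
      gcongr
    have hsum : Summable fun k : ℕ => ‖x₀‖ * ((M * b) ^ k / k.factorial) :=
      (Real.summable_pow_div_factorial _).mul_left _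
    have ht : t ∈ Metric.ball (0 : ℝ) b := by simp [b]
    have hsu : ∀ s ∈ Metric.ball (0 : ℝ) b, Summable (u · s) := fun s hs =>
      Summable.of_norm_bounded hsum (hb s hs)
    have key : HasDerivAt (fun s => ∑' k, u (k + 1) s) (∑' k, A t (u k t)) t := by
      refine hasDerivAt_tsum_of_isPreconnected (hsum.mul_left M) Metric.isOpen_ball
        (convex_ball (0 : ℝ) b).isPreconnected (fun k s _ => hu_deriv k s) (fun k s hs => ?_)
        ht ((summable_nat_add_iff 1).2 (hsu t ht)) ht
      exact (A s).le_of_opNorm_le_of_le (hM s) (hb s hs k)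
    rw [← (A t).map_tsum (hsu t ht)] at key
    refine (key.const_add x₀).congr_of_eventuallyEq ?_
    filter_upwards [Metric.isOpen_ball.mem_nhds ht] with s hs
    exact (hsu s hs).tsum_eq_zero_add

theorem exists_hasDerivAt_clm {E : Type*} [NormedAddCommGroup E] [NormedSpace ℝ E]
    [CompleteSpace E] {a : ℝ} (ha : 0 ≤ a) {A : ℝ → E →L[ℝ] E}
    (hA : ContinuousOn A (Set.Icc 0 a)) (x₀ : E) :
    ∃ x : ℝ → E, x 0 = x₀ ∧ ∀ t ∈ Set.Icc 0 a, HasDerivAt x (A t (x t)) t := by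
  obtain ⟨M, hM⟩ := isCompact_Icc.exists_bound_of_continuousOn hA
  obtain ⟨x, hx0, hx⟩ := exists_hasDerivAt_clm_of_continuous
    (A := Set.IccExtend ha ((Set.Icc 0 a).domRestrict A)) (hA.domRestrict.Icc_extend')
    (fun t => hM _ (Set.projIcc 0 a ha t).2) x₀
  refine ⟨x, hx0, fun t ht => ?_⟩
  have := hx t
  rwa [Set.IccExtend_of_mem ha _ ht] at this

theorem exists_fundamental_solution {F : Type*} [NormedAddCommGroup F] [InnerProductSpace ℝ F]
    [FiniteDimensional ℝ F] {a : ℝ} (ha : 0 ≤ a) {R : ℝ → F →L[ℝ] F}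
    (hR : ContinuousOn R (Set.Icc 0 a)) (V₀ : Submodule ℝ F)
    (h : F →ₗ[ℝ] F →ₗ[ℝ] ℝ) :
    ∃ Y Y' : ℝ → F →L[ℝ] F,
      (∀ t ∈ Set.Icc 0 a, HasDerivAt Y (Y' t) t) ∧
      (∀ t ∈ Set.Icc 0 a, HasDerivAt Y' (-(R t ∘L Y t)) t) ∧
      (∀ u, Y 0 u ∈ V₀) ∧ (∀ u, ∀ w ∈ V₀, ⟪Y' 0 u, w⟫ = - h (Y 0 u) w) ∧
      ∀ u, Y 0 u = 0 → Y' 0 u = 0 → u = 0 := by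
  have := FiniteDimensional.complete ℝ F
  let P : F →L[ℝ] F := V₀.starProjection
  let B : F →L[ℝ] F :=
    (InnerProductSpace.toDual ℝ F).symm.toContinuousLinearEquiv.toContinuousLinearMap ∘L
      h.toContinuousBilinearMap
  have hB : ∀ x w, ⟪B x, w⟫ = h x w := fun x w => by simp [B]
  let L : F →L[ℝ] F × F := P.prod (ContinuousLinearMap.id ℝ F - P - B ∘L P)
  let A : ℝ → F × F →L[ℝ] F × F := fun t =>
    ContinuousLinearMap.inl ℝ F F ∘L ContinuousLinearMap.snd ℝ F F -
      ContinuousLinearMap.inr ℝ F F ∘L R t ∘L ContinuousLinearMap.fst ℝ F F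
  have hA : ContinuousOn A (Set.Icc 0 a) := by
    refine continuousOn_const.sub (continuousOn_const.clm_comp (hR.clm_comp continuousOn_const))
  obtain ⟨Z, hZ0, hZ⟩ := exists_hasDerivAt_clm ha
    (A := fun t => ContinuousLinearMap.compL ℝ F (F × F) (F × F) (A t))
    ((ContinuousLinearMap.continuous _).comp_continuousOn hA) L
  refine ⟨fun t => ContinuousLinearMap.fst ℝ F F ∘L Z t,
    fun t => ContinuousLinearMap.snd ℝ F F ∘L Z t, fun t ht => ?_, fun t ht => ?_,
    fun u => ?_, fun u w hw => ?_, fun u h0 h1 => ?_⟩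
  · refine ((ContinuousLinearMap.compL ℝ F (F × F) F
      (ContinuousLinearMap.fst ℝ F F)).hasFDerivAt.comp_hasDerivAt t (hZ t ht)).congr_deriv ?_
    ext u : 1
    simp [A]
  · refine ((ContinuousLinearMap.compL ℝ F (F × F) F
      (ContinuousLinearMap.snd ℝ F F)).hasFDerivAt.comp_hasDerivAt t (hZ t ht)).congr_deriv ?_
    ext u : 1
    simp [A]
  · simp [hZ0, L, P]
  · have : ⟪u - P u, w⟫ = 0 := V₀.starProjection_inner_eq_zero u w hw
    have e : ⟪u - P u - B (P u), w⟫ = - h (P u) w := by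
      rw [inner_sub_left, this, hB, zero_sub]
    simpa [hZ0, L] using e
  · have hP : P u = 0 := by simpa [hZ0, L] using h0
    simpa [hZ0, L, hP] using h1

theorem intervalIntegrable_inner_of_sq {F : Type*} [NormedAddCommGroup F] [InnerProductSpace ℝ F]
    {a b : ℝ} {f g : ℝ → F} (hab : a ≤ b)
    (hf : AEStronglyMeasurable f (volume.restrict (Set.Ioc a b)))
    (hg : AEStronglyMeasurable g (volume.restrict (Set.Ioc a b)))
    (hf2 : IntervalIntegrable (fun t => ‖f t‖ ^ 2) volume a b)
    (hg2 : IntervalIntegrable (fun t => ‖g t‖ ^ 2) volume a b) :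
    IntervalIntegrable (fun t => ⟪f t, g t⟫) volume a b := by
  rw [intervalIntegrable_iff_integrableOn_Ioc_of_le hab] at *
  refine (hf2.add hg2).mono' (hf.inner hg) (.of_forall fun t => ?_)
  have := norm_inner_le_norm (𝕜 := ℝ) (f t) (g t)
  simp only [Pi.add_apply]
  nlinarith [sq_nonneg (‖f t‖ - ‖g t‖), sq_nonneg ‖f t‖, sq_nonneg ‖g t‖]

/-- A continuous curve on `[0, b]` with derivative `X'` off the finite set `T` and finite energy. -/
structure IsAdmissibleCurve {F : Type*} [NormedAddCommGroup F] [NormedSpace ℝ F]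
    (b : ℝ) (T : Finset ℝ) (X X' : ℝ → F) : Prop where
  continuousOn : ContinuousOn X (Set.Icc 0 b)
  hasDerivAt : ∀ t ∈ Set.Ioo 0 b \ (T : Set ℝ), HasDerivAt X (X' t) t
  integrable_sq : IntervalIntegrable (fun t => ‖X' t‖ ^ 2) volume 0 b

namespace IsAdmissibleCurve

variable {F : Type*} [NormedAddCommGroup F] [InnerProductSpace ℝ F]
  {b c : ℝ} {T : Finset ℝ} {X X' Y Y' : ℝ → F}

theorem mono (hX : IsAdmissibleCurve b T X X') (hc : 0 ≤ c) (hcb : c ≤ b) :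
    IsAdmissibleCurve c T X X' where
  continuousOn := hX.continuousOn.mono (Set.Icc_subset_Icc_right hcb)
  hasDerivAt t ht := hX.hasDerivAt t ⟨⟨ht.1.1, ht.1.2.trans_le hcb⟩, ht.2⟩
  integrable_sq := hX.integrable_sq.mono_set (by
    rw [Set.uIcc_of_le hc, Set.uIcc_of_le (hc.trans hcb)]
    exact Set.Icc_subset_Icc_right hcb)

theorem intervalIntegrable_inner_clm {R : ℝ → F →L[ℝ] F} (hR : ContinuousOn R (Set.Icc 0 b))
    (hb : 0 ≤ b) (hX : IsAdmissibleCurve b T X X') (hY : IsAdmissibleCurve b T Y Y') :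
    IntervalIntegrable (fun t => ⟪R t (X t), Y t⟫) volume 0 b := by
  refine ContinuousOn.intervalIntegrable ?_
  rw [Set.uIcc_of_le hb]
  exact (hR.clm_apply hX.continuousOn).inner hY.continuousOn

variable [FiniteDimensional ℝ F]

theorem aestronglyMeasurable_deriv (hX : IsAdmissibleCurve b T X X') :
    AEStronglyMeasurable X' (volume.restrict (Set.Ioc 0 b)) := by
  have := FiniteDimensional.complete ℝ F
  have := FiniteDimensional.proper_real F
  refine (stronglyMeasurable_deriv X).aestronglyMeasurable.congr ?_
  rw [← restrict_Ioo_eq_restrict_Ioc]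
  filter_upwards [ae_restrict_mem measurableSet_Ioo,
    ae_restrict_of_ae (measure_eq_zero_iff_ae_notMem.1 (T.finite_toSet.measure_zero volume))]
    with t ht hT
  exact (hX.hasDerivAt t ⟨ht, hT⟩).deriv

theorem intervalIntegrable_inner (hb : 0 ≤ b) (hX : IsAdmissibleCurve b T X X')
    (hY : IsAdmissibleCurve b T Y Y') :
    IntervalIntegrable (fun t => ⟪X' t, Y' t⟫) volume 0 b :=
  intervalIntegrable_inner_of_sq hb hX.aestronglyMeasurable_deriv hY.aestronglyMeasurable_deriv
    hX.integrable_sq hY.integrable_sq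

theorem intervalIntegrable_deriv (hb : 0 ≤ b) (hX : IsAdmissibleCurve b T X X') :
    IntervalIntegrable X' volume 0 b := by
  have hX2 := hX.integrable_sq
  rw [intervalIntegrable_iff_integrableOn_Ioc_of_le hb] at *
  have h1 : IntegrableOn (fun _ : ℝ => (1 : ℝ)) (Set.Ioc 0 b) := by simp
  refine (h1.add hX2).mono' hX.aestronglyMeasurable_deriv (.of_forall fun t => ?_)
  simp only [Pi.add_apply]
  nlinarith [sq_nonneg (‖X' t‖ - 1)]

theorem sub (hb : 0 ≤ b) (hX : IsAdmissibleCurve b T X X') (hY : IsAdmissibleCurve b T Y Y') :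
    IsAdmissibleCurve b T (fun t => X t - Y t) (fun t => X' t - Y' t) where
  continuousOn := hX.continuousOn.sub hY.continuousOn
  hasDerivAt t ht := (hX.hasDerivAt t ht).sub (hY.hasDerivAt t ht)
  integrable_sq := by
    refine ((hX.integrable_sq.sub ((intervalIntegrable_inner hb hX hY).const_mul 2)).add
      hY.integrable_sq).congr fun t _ => ?_
    exact (norm_sub_sq_real _ _).symm

theorem sq_norm_le_of_eq_zero (hb : 0 < b) (hX : IsAdmissibleCurve b T X X') (hXb : X b = 0)
    {s : ℝ} (hs : s ∈ Set.Icc 0 b) : ‖X s‖ ^ 2 ≤ b * ∫ t in (0 : ℝ)..b, ‖X' t‖ ^ 2 := by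
  have := FiniteDimensional.complete ℝ F
  have hint := hX.intervalIntegrable_deriv hb.le
  set m := ∫ t in (0 : ℝ)..b, ‖X' t‖ with hm
  set Q := ∫ t in (0 : ℝ)..b, ‖X' t‖ ^ 2 with hQ
  have hsub : Set.Icc s b ⊆ Set.Icc 0 b := Set.Icc_subset_Icc_left hs.1
  have hints : IntervalIntegrable X' volume s b := hint.mono_set (by
    rwa [Set.uIcc_of_le hs.2, Set.uIcc_of_le hb.le])
  have hftc : ∫ t in s..b, X' t = X b - X s :=
    integral_eq_of_hasDerivAt_off_countable_of_le X X' hs.2 T.finite_toSet.countable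
      (hX.continuousOn.mono hsub)
      (fun t ht => hX.hasDerivAt t ⟨⟨hs.1.trans_lt ht.1.1, ht.1.2⟩, ht.2⟩) hints
  have h1 : ‖X s‖ ≤ m := by
    have e : X s = - ∫ t in s..b, X' t := by rw [hftc, hXb]; simp
    rw [e, norm_neg]
    refine (intervalIntegral.norm_integral_le_integral_norm hs.2).trans ?_
    exact intervalIntegral.integral_mono_interval hs.1 hs.2 le_rfl
      (.of_forall fun t => norm_nonneg _) hint.norm
  have h2 : 0 ≤ ∫ t in (0 : ℝ)..b, (b * ‖X' t‖ - m) ^ 2 :=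
    intervalIntegral.integral_nonneg hb.le fun _ _ => sq_nonneg _
  have h3 : ∫ t in (0 : ℝ)..b, (b * ‖X' t‖ - m) ^ 2 = b * (b * Q - m ^ 2) := by
    have e : ∀ t, (b * ‖X' t‖ - m) ^ 2 = b ^ 2 * ‖X' t‖ ^ 2 - 2 * b * m * ‖X' t‖ + m ^ 2 :=
      fun t => by ring
    simp_rw [e]
    rw [intervalIntegral.integral_add ((hX.integrable_sq.const_mul _).sub (hint.norm.const_mul _))
      (by simp), intervalIntegral.integral_sub (hX.integrable_sq.const_mul _)
      (hint.norm.const_mul _), intervalIntegral.integral_const_mul,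
      intervalIntegral.integral_const_mul, ← hm, ← hQ, intervalIntegral.integral_const]
    simp only [smul_eq_mul]
    ring
  rw [h3] at h2
  have h4 := nonneg_of_mul_nonneg_right h2 hb
  nlinarith [norm_nonneg (X s)]

end IsAdmissibleCurve

section

variable {n : ℕ} {a b : ℝ}
  {R : ℝ → EuclideanSpace ℝ (Fin n) →L[ℝ] EuclideanSpace ℝ (Fin n)}
  {V₀ : Submodule ℝ (EuclideanSpace ℝ (Fin n))}
  {h : EuclideanSpace ℝ (Fin n) →ₗ[ℝ] EuclideanSpace ℝ (Fin n) →ₗ[ℝ] ℝ}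
  {T : Finset ℝ} {X X' : ℝ → EuclideanSpace ℝ (Fin n)}

theorem exists_forall_le_indexForm_nonneg (hR : ContinuousOn R (Set.Icc 0 a))
    (h : EuclideanSpace ℝ (Fin n) →ₗ[ℝ] EuclideanSpace ℝ (Fin n) →ₗ[ℝ] ℝ) :
    ∃ δ > 0, ∀ b, 0 < b → b ≤ δ → b ≤ a → ∀ (T : Finset ℝ)
      (X X' : ℝ → EuclideanSpace ℝ (Fin n)), IsAdmissibleCurve b T X X' → X b = 0 →
      0 ≤ indexForm n b R h X X' X X' := by
  obtain ⟨M, hM⟩ := isCompact_Icc.exists_bound_of_continuousOn hR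
  set C := ‖h.toContinuousBilinearMap‖
  have hC : 0 ≤ C := norm_nonneg h.toContinuousBilinearMap
  refine ⟨min 1 (1 / (C + |M| + 1)), by positivity, fun b hb hbδ hba T X X' hX hXb => ?_⟩
  have hb1 : b ≤ 1 := hbδ.trans (min_le_left _ _)
  have hb2 : b * (C + |M| + 1) ≤ 1 := (le_div_iff₀ (by positivity)).1 (hbδ.trans (min_le_right _ _))
  set Q := ∫ t in (0 : ℝ)..b, ‖X' t‖ ^ 2
  have hQ : 0 ≤ Q := intervalIntegral.integral_nonneg hb.le fun _ _ => sq_nonneg _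
  have hRb := hR.mono (Set.Icc_subset_Icc_right hba)
  have hh : h (X 0) (X 0) ≤ C * (b * Q) := by
    have h1 := (Real.le_norm_self _).trans
      (h.toContinuousBilinearMap.le_opNorm₂ (X 0) (X 0))
    have h2 := hX.sq_norm_le_of_eq_zero hb hXb (Set.left_mem_Icc.2 hb.le)
    calc h (X 0) (X 0) ≤ C * ‖X 0‖ * ‖X 0‖ := h1
      _ = C * ‖X 0‖ ^ 2 := by ring
      _ ≤ _ := by gcongr
  have hcurv : ∫ t in (0 : ℝ)..b, ⟪R t (X t), X t⟫ ≤ b * (|M| * (b * Q)) := by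
    calc ∫ t in (0 : ℝ)..b, ⟪R t (X t), X t⟫ ≤ ∫ t in (0 : ℝ)..b, |M| * (b * Q) := by
          refine intervalIntegral.integral_mono_on hb.le
            (hX.intervalIntegrable_inner_clm hRb hb.le hX) (by simp) fun t ht => ?_
          calc ⟪R t (X t), X t⟫ ≤ ‖R t (X t)‖ * ‖X t‖ := real_inner_le_norm _ _
            _ ≤ |M| * ‖X t‖ * ‖X t‖ := by
                gcongr
                exact (R t).le_of_opNorm_le
                  ((hM t ⟨ht.1, ht.2.trans hba⟩).trans (le_abs_self M)) _
            _ = |M| * ‖X t‖ ^ 2 := by ring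
            _ ≤ _ := by
                gcongr
                exact hX.sq_norm_le_of_eq_zero hb hXb ht
      _ = _ := by simp only [intervalIntegral.integral_const, smul_eq_mul, sub_zero]
  have hsplit : indexForm n b R h X X' X X' =
      - h (X 0) (X 0) + (Q - ∫ t in (0 : ℝ)..b, ⟪R t (X t), X t⟫) := by
    unfold indexForm
    rw [intervalIntegral.integral_sub (hX.intervalIntegrable_inner hb.le hX)
      (hX.intervalIntegrable_inner_clm hRb hb.le hX)]
    simp_rw [real_inner_self_eq_norm_sq]
    rfl
  have hM2 : b * (|M| * (b * Q)) ≤ |M| * (b * Q) :=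
    mul_le_of_le_one_left (by positivity) hb1
  rw [hsplit]
  nlinarith

theorem indexForm_comm (hb : 0 ≤ b)
    (hRsym : ∀ t ∈ Set.Icc 0 b, ∀ x y : EuclideanSpace ℝ (Fin n), ⟪R t x, y⟫ = ⟪x, R t y⟫)
    (hsym : ∀ x ∈ V₀, ∀ y ∈ V₀, h x y = h y x) {Y Y' : ℝ → EuclideanSpace ℝ (Fin n)}
    (hX0 : X 0 ∈ V₀) (hY0 : Y 0 ∈ V₀) :
    indexForm n b R h X X' Y Y' = indexForm n b R h Y Y' X X' := by
  unfold indexForm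
  rw [hsym _ hX0 _ hY0]
  congr 1
  refine intervalIntegral.integral_congr fun t ht => ?_
  rw [Set.uIcc_of_le hb] at ht
  rw [hRsym t ht, real_inner_comm, real_inner_comm (R t (Y t))]

theorem indexForm_sub_sub (hb : 0 ≤ b) (hR : ContinuousOn R (Set.Icc 0 b))
    {Y Y' : ℝ → EuclideanSpace ℝ (Fin n)} (hX : IsAdmissibleCurve b T X X')
    (hY : IsAdmissibleCurve b T Y Y') :
    indexForm n b R h (fun t => X t - Y t) (fun t => X' t - Y' t)
        (fun t => X t - Y t) (fun t => X' t - Y' t) =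
      indexForm n b R h X X' X X' - indexForm n b R h X X' Y Y' -
        indexForm n b R h Y Y' X X' + indexForm n b R h Y Y' Y Y' := by
  have key : ∀ {U U' W W' : ℝ → EuclideanSpace ℝ (Fin n)}, IsAdmissibleCurve b T U U' →
      IsAdmissibleCurve b T W W' →
      IntervalIntegrable (fun t => ⟪U' t, W' t⟫ - ⟪R t (U t), W t⟫) volume 0 b := fun hU hW =>
    (hU.intervalIntegrable_inner hb hW).sub (hU.intervalIntegrable_inner_clm hR hb hW)
  have e : ∀ t, ⟪X' t - Y' t, X' t - Y' t⟫ - ⟪R t (X t - Y t), X t - Y t⟫ =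
      (⟪X' t, X' t⟫ - ⟪R t (X t), X t⟫) - (⟪X' t, Y' t⟫ - ⟪R t (X t), Y t⟫) -
        (⟪Y' t, X' t⟫ - ⟪R t (Y t), X t⟫) + (⟪Y' t, Y' t⟫ - ⟪R t (Y t), Y t⟫) := fun t => by
    simp only [map_sub, inner_sub_left, inner_sub_right]
    ring
  unfold indexForm
  simp_rw [e]
  rw [intervalIntegral.integral_add (((key hX hX).sub (key hX hY)).sub (key hY hX)) (key hY hY),
    intervalIntegral.integral_sub ((key hX hX).sub (key hX hY)) (key hY hX),
    intervalIntegral.integral_sub (key hX hX) (key hX hY)]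
  simp only [map_sub, LinearMap.sub_apply]
  ring

namespace TransverseJacobi

/-- The restriction of a transverse Jacobi solution to a shorter interval. -/
def restrict (K : TransverseJacobi n a R V₀ h) (hba : b ≤ a) : TransverseJacobi n b R V₀ h where
  J := K.J
  J' := K.J'
  hasDeriv t ht := (K.hasDeriv t ⟨ht.1, ht.2.trans hba⟩).mono (Set.Icc_subset_Icc_right hba)
  hasDeriv' t ht := (K.hasDeriv' t ⟨ht.1, ht.2.trans hba⟩).mono (Set.Icc_subset_Icc_right hba)
  init_mem := K.init_mem
  init_deriv := K.init_deriv

/-- The difference of two transverse Jacobi solutions. -/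
def sub (K K' : TransverseJacobi n a R V₀ h) : TransverseJacobi n a R V₀ h where
  J t := K.J t - K'.J t
  J' t := K.J' t - K'.J' t
  hasDeriv t ht := (K.hasDeriv t ht).sub (K'.hasDeriv t ht)
  hasDeriv' t ht := ((K.hasDeriv' t ht).sub (K'.hasDeriv' t ht)).congr_deriv (by
    rw [map_sub]; abel)
  init_mem := V₀.sub_mem K.init_mem K'.init_mem
  init_deriv w hw := by
    rw [inner_sub_left, K.init_deriv w hw, K'.init_deriv w hw, map_sub, LinearMap.sub_apply]
    ring

theorem continuousOn_deriv (K : TransverseJacobi n a R V₀ h) :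
    ContinuousOn K.J' (Set.Icc 0 a) := fun t ht => (K.hasDeriv' t ht).continuousWithinAt

theorem isAdmissibleCurve (K : TransverseJacobi n a R V₀ h) (ha : 0 ≤ a) (T : Finset ℝ) :
    IsAdmissibleCurve a T K.J K.J' where
  continuousOn t ht := (K.hasDeriv t ht).continuousWithinAt
  hasDerivAt t ht := (K.hasDeriv t (Set.Ioo_subset_Icc_self ht.1)).hasDerivAt
    (Icc_mem_nhds ht.1.1 ht.1.2)
  integrable_sq := by
    refine ContinuousOn.intervalIntegrable ?_
    rw [Set.uIcc_of_le ha]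
    exact K.continuousOn_deriv.norm.pow 2

theorem indexForm_left (K : TransverseJacobi n b R V₀ h) (hb : 0 ≤ b)
    (hR : ContinuousOn R (Set.Icc 0 b)) (hX : IsAdmissibleCurve b T X X') (hX0 : X 0 ∈ V₀) :
    indexForm n b R h K.J K.J' X X' = ⟪K.J' b, X b⟫ := by
  have hK := K.isAdmissibleCurve hb T
  have hftc : ∫ t in (0 : ℝ)..b, (⟪K.J' t, X' t⟫ - ⟪R t (K.J t), X t⟫) =
      ⟪K.J' b, X b⟫ - ⟪K.J' 0, X 0⟫ := by
    refine integral_eq_of_hasDerivAt_off_countable_of_le (fun t => ⟪K.J' t, X t⟫) _ hb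
      T.finite_toSet.countable (K.continuousOn_deriv.inner hX.continuousOn) (fun t ht => ?_)
      ((hK.intervalIntegrable_inner hb hX).sub (hK.intervalIntegrable_inner_clm hR hb hX))
    refine (((K.hasDeriv' t (Set.Ioo_subset_Icc_self ht.1)).hasDerivAt
      (Icc_mem_nhds ht.1.1 ht.1.2)).inner ℝ (hX.hasDerivAt t ht)).congr_deriv ?_
    rw [inner_neg_left, sub_eq_add_neg]
  unfold indexForm
  rw [hftc, K.init_deriv _ hX0]
  ring

theorem indexForm_sub_eq (K : TransverseJacobi n b R V₀ h) (hb : 0 ≤ b)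
    (hR : ContinuousOn R (Set.Icc 0 b))
    (hRsym : ∀ t ∈ Set.Icc 0 b, ∀ x y : EuclideanSpace ℝ (Fin n), ⟪R t x, y⟫ = ⟪x, R t y⟫)
    (hsym : ∀ x ∈ V₀, ∀ y ∈ V₀, h x y = h y x) (hX : IsAdmissibleCurve b T X X')
    (hX0 : X 0 ∈ V₀) (hKX : K.J b = X b) :
    indexForm n b R h (fun t => X t - K.J t) (fun t => X' t - K.J' t)
        (fun t => X t - K.J t) (fun t => X' t - K.J' t) =
      indexForm n b R h X X' X X' - ⟪K.J' b, X b⟫ := by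
  have hK := K.isAdmissibleCurve hb T
  rw [indexForm_sub_sub hb hR hX hK, indexForm_comm hb hRsym hsym hX0 K.init_mem,
    K.indexForm_left hb hR hX hX0, K.indexForm_left hb hR hK K.init_mem, hKX]
  ring

theorem inner_deriv_comm (K K' : TransverseJacobi n a R V₀ h) (hR : ContinuousOn R (Set.Icc 0 a))
    (hRsym : ∀ t ∈ Set.Icc 0 a, ∀ x y : EuclideanSpace ℝ (Fin n), ⟪R t x, y⟫ = ⟪x, R t y⟫)
    (hsym : ∀ x ∈ V₀, ∀ y ∈ V₀, h x y = h y x) {t : ℝ} (ht : t ∈ Set.Icc 0 a) :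
    ⟪K.J' t, K'.J t⟫ = ⟪K'.J' t, K.J t⟫ := by
  have hsub : Set.Icc 0 t ⊆ Set.Icc 0 a := Set.Icc_subset_Icc_right ht.2
  have e := indexForm_comm (X' := K.J') (Y' := K'.J') ht.1 (fun s hs => hRsym s (hsub hs)) hsym
    K.init_mem K'.init_mem
  exact ((K.restrict ht.2).indexForm_left ht.1 (hR.mono hsub)
    ((K'.restrict ht.2).isAdmissibleCurve ht.1 ∅) K'.init_mem).symm.trans (e.trans
      ((K'.restrict ht.2).indexForm_left ht.1 (hR.mono hsub)
        ((K.restrict ht.2).isAdmissibleCurve ht.1 ∅) K.init_mem))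

end TransverseJacobi

/-- The coordinate curve `c = Y⁻¹ X` of `X` in the moving frame `Y`. -/
noncomputable def frameCoord {F : Type*} [NormedAddCommGroup F] [NormedSpace ℝ F]
    (Y : ℝ → F →L[ℝ] F) (X : ℝ → F) (t : ℝ) : F :=
  Ring.inverse (Y t) (X t)

section frameCoord

variable {F : Type*} [NormedAddCommGroup F] [InnerProductSpace ℝ F]
  {a ε t : ℝ} {T : Finset ℝ} {X X' : ℝ → F} {Y Y' : ℝ → F →L[ℝ] F}

theorem apply_frameCoord (hY : IsUnit (Y t)) : Y t (frameCoord Y X t) = X t := by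
  rw [frameCoord, ← mul_apply_eq_comp, Ring.mul_inverse_cancel _ hY]
  rfl

variable [FiniteDimensional ℝ F]

theorem continuousOn_frameCoord {s : Set ℝ} (hY : ContinuousOn Y s) (hX : ContinuousOn X s)
    (hu : ∀ t ∈ s, IsUnit (Y t)) : ContinuousOn (frameCoord Y X) s := by
  have := FiniteDimensional.complete ℝ F
  refine ContinuousOn.clm_apply (fun t ht => ?_) hX
  exact (differentiableAt_inverse (𝕜 := ℝ) (hu t ht)).continuousAt.comp_continuousWithinAt (hY t ht)

theorem hasDerivAt_frameCoord {Yt' : F →L[ℝ] F} {Xt' : F} (hY : HasDerivAt Y Yt' t)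
    (hX : HasDerivAt X Xt' t) (hu : ∀ᶠ s in nhds t, IsUnit (Y s)) :
    HasDerivAt (frameCoord Y X) (Ring.inverse (Y t) (Xt' - Yt' (frameCoord Y X t))) t := by
  have := FiniteDimensional.complete ℝ F
  have hd : DifferentiableAt ℝ (frameCoord Y X) t :=
    ((differentiableAt_inverse hu.self_of_nhds).comp t hY.differentiableAt).clm_apply
      hX.differentiableAt
  have h1 : HasDerivAt X (Yt' (frameCoord Y X t) + Y t (deriv (frameCoord Y X) t)) t :=
    (hY.clm_apply hd.hasDerivAt).congr_of_eventuallyEq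
      (hu.mono fun s hs => (apply_frameCoord hs).symm)
  convert hd.hasDerivAt using 1
  rw [hX.unique h1, add_sub_cancel_left, ← mul_apply_eq_comp,
    Ring.inverse_mul_cancel _ hu.self_of_nhds]
  rfl

theorem continuousOn_deriv_frameCoord (hε : 0 < ε) (hX : IsAdmissibleCurve a T X X')
    (hY : ContinuousOn Y (Set.Icc 0 a)) (hY' : ContinuousOn Y' (Set.Icc 0 a))
    (hu : ∀ t ∈ Set.Ioc 0 a, IsUnit (Y t)) :
    ContinuousOn (fun t => Y' t (frameCoord Y X t)) (Set.Icc ε a) := by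
  have hsub : Set.Icc ε a ⊆ Set.Icc 0 a := Set.Icc_subset_Icc_left hε.le
  exact (hY'.mono hsub).clm_apply (continuousOn_frameCoord (hY.mono hsub)
    (hX.continuousOn.mono hsub) fun t ht => hu t ⟨hε.trans_le ht.1, ht.2⟩)

theorem intervalIntegrable_sq_sub_frameCoord (hε : 0 < ε) (hεa : ε ≤ a)
    (hX : IsAdmissibleCurve a T X X') (hY : ContinuousOn Y (Set.Icc 0 a))
    (hY' : ContinuousOn Y' (Set.Icc 0 a)) (hu : ∀ t ∈ Set.Ioc 0 a, IsUnit (Y t)) :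
    IntervalIntegrable (fun t => ‖X' t - Y' t (frameCoord Y X t)‖ ^ 2) volume ε a := by
  have := FiniteDimensional.proper_real F
  have hg := continuousOn_deriv_frameCoord hε hX hY hY' hu
  have hX2 : IntervalIntegrable (fun t => ‖X' t‖ ^ 2) volume ε a :=
    hX.integrable_sq.mono_set (by
      rw [Set.uIcc_of_le hεa, Set.uIcc_of_le (hε.le.trans hεa)]
      exact Set.Icc_subset_Icc_left hε.le)
  have hg2 : IntervalIntegrable (fun t => ‖Y' t (frameCoord Y X t)‖ ^ 2) volume ε a := by
    refine ContinuousOn.intervalIntegrable ?_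
    rw [Set.uIcc_of_le hεa]
    exact hg.norm.pow 2
  have hXg : IntervalIntegrable (fun t => ⟪X' t, Y' t (frameCoord Y X t)⟫) volume ε a :=
    intervalIntegrable_inner_of_sq hεa
      (hX.aestronglyMeasurable_deriv.mono_set (Set.Ioc_subset_Ioc_left hε.le))
      ((hg.mono Set.Ioc_subset_Icc_self).aestronglyMeasurable measurableSet_Ioc) hX2 hg2
  exact ((hX2.sub (hXg.const_mul 2)).add hg2).congr fun t _ => (norm_sub_sq_real _ _).symm

theorem integral_index_eq_add_integral_sq {R : ℝ → F →L[ℝ] F}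
    (hR : ContinuousOn R (Set.Icc 0 a)) (hε : 0 < ε) (hεa : ε ≤ a)
    (hX : IsAdmissibleCurve a T X X') (hY : ∀ t ∈ Set.Icc 0 a, HasDerivAt Y (Y' t) t)
    (hY' : ∀ t ∈ Set.Icc 0 a, HasDerivAt Y' (-(R t ∘L Y t)) t)
    (hu : ∀ t ∈ Set.Ioc 0 a, IsUnit (Y t))
    (hW : ∀ t ∈ Set.Icc 0 a, ∀ u v, ⟪Y' t u, Y t v⟫ = ⟪Y' t v, Y t u⟫) :
    ∫ t in ε..a, (⟪X' t, X' t⟫ - ⟪R t (X t), X t⟫) =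
      ⟪Y' a (frameCoord Y X a), X a⟫ - ⟪Y' ε (frameCoord Y X ε), X ε⟫ +
        ∫ t in ε..a, ‖X' t - Y' t (frameCoord Y X t)‖ ^ 2 := by
  have := FiniteDimensional.complete ℝ F
  have ha : 0 < a := hε.trans_le hεa
  have hsub : Set.Icc ε a ⊆ Set.Icc 0 a := Set.Icc_subset_Icc_left hε.le
  have hsub' : Set.Icc ε a ⊆ Set.Ioc 0 a := fun t ht => ⟨hε.trans_le ht.1, ht.2⟩
  have huIcc : Set.uIcc ε a ⊆ Set.uIcc 0 a := by
    rwa [Set.uIcc_of_le hεa, Set.uIcc_of_le ha.le]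
  set c := frameCoord Y X
  have hXc := hX.continuousOn.mono hsub
  have hYc := HasDerivAt.continuousOn hY
  have hYc' := HasDerivAt.continuousOn hY'
  have hsq := intervalIntegrable_sq_sub_frameCoord hε hεa hX hYc hYc' hu
  have hq : IntervalIntegrable (fun t => ⟪X' t, X' t⟫ - ⟪R t (X t), X t⟫) volume ε a :=
    ((hX.intervalIntegrable_inner ha.le hX).sub
      (hX.intervalIntegrable_inner_clm hR ha.le hX)).mono_set huIcc
  rw [← sub_eq_iff_eq_add, ← intervalIntegral.integral_sub hq hsq]
  refine integral_eq_of_hasDerivAt_off_countable_of_le (fun t => ⟪Y' t (c t), X t⟫) _ hεa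
    T.finite_toSet.countable ((continuousOn_deriv_frameCoord hε hX hYc hYc' hu).inner hXc)
    (fun t ht => ?_) (hq.sub hsq)
  have ht0 : t ∈ Set.Icc 0 a := hsub (Set.Ioo_subset_Icc_self ht.1)
  have hut : ∀ᶠ s in nhds t, IsUnit (Y s) := by
    filter_upwards [Ioo_mem_nhds ht.1.1 ht.1.2] with s hs
    exact hu s (hsub' (Set.Ioo_subset_Icc_self hs))
  have hXt : HasDerivAt X (X' t) t := hX.hasDerivAt t ⟨⟨hε.trans ht.1.1, ht.1.2⟩, ht.2⟩
  have hct := hasDerivAt_frameCoord (hY t ht0) hXt hut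
  refine (((hY' t ht0).clm_apply hct).inner ℝ hXt).congr_deriv ?_
  have hYc : Y t (c t) = X t := apply_frameCoord hut.self_of_nhds
  have hYc' : Y t (Ring.inverse (Y t) (X' t - Y' t (c t))) = X' t - Y' t (c t) := by
    rw [← mul_apply_eq_comp, Ring.mul_inverse_cancel _ hut.self_of_nhds]
    rfl
  have hWt := hW t ht0 (Ring.inverse (Y t) (X' t - Y' t (c t))) (c t)
  rw [hYc, hYc'] at hWt
  change ⟪Y' t (c t), X' t⟫ + ⟪-(R t (Y t (c t))) + Y' t (Ring.inverse (Y t) _), X t⟫ = _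
  rw [inner_add_left, hWt, hYc, inner_neg_left, norm_sub_sq_real, inner_sub_right,
    real_inner_self_eq_norm_sq, real_inner_self_eq_norm_sq, real_inner_comm (X' t)]
  ring

theorem frameCoord_eq_of_integral_sq_eq_zero (hε : 0 < ε) (hεa : ε ≤ a)
    (hX : IsAdmissibleCurve a T X X') (hY : ∀ t ∈ Set.Icc 0 a, HasDerivAt Y (Y' t) t)
    (hY' : ContinuousOn Y' (Set.Icc 0 a)) (hu : ∀ t ∈ Set.Ioc 0 a, IsUnit (Y t))
    (h0 : ∫ t in ε..a, ‖X' t - Y' t (frameCoord Y X t)‖ ^ 2 = 0) :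
    frameCoord Y X ε = frameCoord Y X a := by
  have := FiniteDimensional.complete ℝ F
  have hsub : Set.Icc ε a ⊆ Set.Icc 0 a := Set.Icc_subset_Icc_left hε.le
  have hsub' : Set.Icc ε a ⊆ Set.Ioc 0 a := fun t ht => ⟨hε.trans_le ht.1, ht.2⟩
  have hYc := HasDerivAt.continuousOn hY
  have hae := (intervalIntegral.integral_eq_zero_iff_of_le_of_nonneg_ae hεa
    (.of_forall fun t => sq_nonneg _)
    (intervalIntegrable_sq_sub_frameCoord hε hεa hX hYc hY' hu)).1 h0
  have hae' : (fun t => Ring.inverse (Y t) (X' t - Y' t (frameCoord Y X t)))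
      =ᵐ[volume.restrict (Set.Ioc ε a)] fun _ => 0 := by
    filter_upwards [hae] with t ht
    have : X' t - Y' t (frameCoord Y X t) = 0 := by simpa using ht
    rw [this, map_zero]
  have hint : IntervalIntegrable
      (fun t => Ring.inverse (Y t) (X' t - Y' t (frameCoord Y X t))) volume ε a := by
    rw [intervalIntegrable_iff_integrableOn_Ioc_of_le hεa]
    exact (integrable_zero ℝ F _).congr hae'.symm
  have hftc := integral_eq_of_hasDerivAt_off_countable_of_le (frameCoord Y X) _ hεa
    T.finite_toSet.countable
    (continuousOn_frameCoord (hYc.mono hsub)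
      (hX.continuousOn.mono hsub) fun t ht => hu t (hsub' ht)) (fun t ht => by
        refine hasDerivAt_frameCoord (hY t (hsub (Set.Ioo_subset_Icc_self ht.1)))
          (hX.hasDerivAt t ⟨⟨hε.trans ht.1.1, ht.1.2⟩, ht.2⟩) ?_
        filter_upwards [Ioo_mem_nhds ht.1.1 ht.1.2] with s hs
        exact hu s (hsub' (Set.Ioo_subset_Icc_self hs))) hint
  rw [intervalIntegral.integral_of_le hεa, integral_congr_ae hae', integral_zero] at hftc
  exact (sub_eq_zero.1 hftc.symm).symm

end frameCoord

/-- An operator-valued solution `Y` of the Jacobi equation all of whose columns are transverse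
Jacobi solutions and which is invertible on `(0, a]`. -/
structure IsJacobiFrame (a : ℝ)
    (R : ℝ → EuclideanSpace ℝ (Fin n) →L[ℝ] EuclideanSpace ℝ (Fin n))
    (V₀ : Submodule ℝ (EuclideanSpace ℝ (Fin n)))
    (h : EuclideanSpace ℝ (Fin n) →ₗ[ℝ] EuclideanSpace ℝ (Fin n) →ₗ[ℝ] ℝ)
    (Y Y' : ℝ → EuclideanSpace ℝ (Fin n) →L[ℝ] EuclideanSpace ℝ (Fin n)) : Prop where
  hasDerivAt : ∀ t ∈ Set.Icc 0 a, HasDerivAt Y (Y' t) t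
  hasDerivAt_deriv : ∀ t ∈ Set.Icc 0 a, HasDerivAt Y' (-(R t ∘L Y t)) t
  init_mem : ∀ u, Y 0 u ∈ V₀
  init_deriv : ∀ u, ∀ w ∈ V₀, ⟪Y' 0 u, w⟫ = - h (Y 0 u) w
  isUnit : ∀ t ∈ Set.Ioc 0 a, IsUnit (Y t)

/-- The transverse Jacobi solution `t ↦ Y t u`. -/
def TransverseJacobi.ofColumn {Y Y' : ℝ → EuclideanSpace ℝ (Fin n) →L[ℝ] EuclideanSpace ℝ (Fin n)}
    (hY : ∀ t ∈ Set.Icc 0 a, HasDerivAt Y (Y' t) t)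
    (hY' : ∀ t ∈ Set.Icc 0 a, HasDerivAt Y' (-(R t ∘L Y t)) t) (h0 : ∀ u, Y 0 u ∈ V₀)
    (h1 : ∀ u, ∀ w ∈ V₀, ⟪Y' 0 u, w⟫ = - h (Y 0 u) w) (u : EuclideanSpace ℝ (Fin n)) :
    TransverseJacobi n a R V₀ h where
  J t := Y t u
  J' t := Y' t u
  hasDeriv t ht := (((hY t ht).clm_apply (hasDerivAt_const t u)).congr_deriv
    (by simp)).hasDerivWithinAt
  hasDeriv' t ht := (((hY' t ht).clm_apply (hasDerivAt_const t u)).congr_deriv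
    (by simp)).hasDerivWithinAt
  init_mem := h0 u
  init_deriv := h1 u

theorem exists_isJacobiFrame (ha : 0 < a) (hR : ContinuousOn R (Set.Icc 0 a))
    (hfocal : ∀ K : TransverseJacobi n a R V₀ h, ∀ t ∈ Set.Ioc 0 a,
      K.J t = 0 → ∀ s ∈ Set.Icc 0 a, K.J s = 0) :
    ∃ Y Y' : ℝ → EuclideanSpace ℝ (Fin n) →L[ℝ] EuclideanSpace ℝ (Fin n),
      IsJacobiFrame a R V₀ h Y Y' := by
  obtain ⟨Y, Y', hY, hY', h0, h1, hinj⟩ := exists_fundamental_solution ha.le hR V₀ h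
  refine ⟨Y, Y', hY, hY', h0, h1, fun t ht => ?_⟩
  have hker : ∀ u, Y t u = 0 → u = 0 := fun u hu => by
    have hz := hfocal (.ofColumn hY hY' h0 h1 u) t ht hu
    have hmem : (0 : ℝ) ∈ Set.Icc 0 a := Set.left_mem_Icc.2 ha.le
    refine hinj u (hz 0 hmem) ?_
    have hd := (TransverseJacobi.ofColumn hY hY' h0 h1 u).hasDeriv 0 hmem
    exact (uniqueDiffOn_Icc ha 0 hmem).eq_deriv _ hd
      ((hasDerivWithinAt_const 0 _ 0).congr hz (hz 0 hmem))
  have hinjt : Function.Injective (Y t) := (injective_iff_map_eq_zero (Y t)).2 hker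
  exact ContinuousLinearMap.isUnit_iff_bijective.2
    ⟨hinjt, LinearMap.injective_iff_surjective (f := (Y t).toLinearMap).1 hinjt⟩

namespace IsJacobiFrame

variable {Y Y' : ℝ → EuclideanSpace ℝ (Fin n) →L[ℝ] EuclideanSpace ℝ (Fin n)}

theorem mono (hY : IsJacobiFrame a R V₀ h Y Y') (hba : b ≤ a) : IsJacobiFrame b R V₀ h Y Y' where
  hasDerivAt t ht := hY.hasDerivAt t ⟨ht.1, ht.2.trans hba⟩
  hasDerivAt_deriv t ht := hY.hasDerivAt_deriv t ⟨ht.1, ht.2.trans hba⟩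
  init_mem := hY.init_mem
  init_deriv := hY.init_deriv
  isUnit t ht := hY.isUnit t ⟨ht.1, ht.2.trans hba⟩

/-- The transverse Jacobi solution `t ↦ Y t u` of a frame. -/
def column (hY : IsJacobiFrame a R V₀ h Y Y') (u : EuclideanSpace ℝ (Fin n)) :
    TransverseJacobi n a R V₀ h :=
  .ofColumn hY.hasDerivAt hY.hasDerivAt_deriv hY.init_mem hY.init_deriv u

theorem index_sub_eq_add_integral_sq (hY : IsJacobiFrame a R V₀ h Y Y') (hb : 0 < b) (hba : b ≤ a)
    (hR : ContinuousOn R (Set.Icc 0 a))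
    (hRsym : ∀ t ∈ Set.Icc 0 a, ∀ x y : EuclideanSpace ℝ (Fin n), ⟪R t x, y⟫ = ⟪x, R t y⟫)
    (hsym : ∀ x ∈ V₀, ∀ y ∈ V₀, h x y = h y x) (hX : IsAdmissibleCurve a T X X') :
    indexForm n a R h X X' X X' - ⟪Y' a (frameCoord Y X a), X a⟫ =
      indexForm n b R h X X' X X' - ⟪Y' b (frameCoord Y X b), X b⟫ +
        ∫ t in b..a, ‖X' t - Y' t (frameCoord Y X t)‖ ^ 2 := by
  have ha : 0 < a := hb.trans_le hba
  have hint : IntervalIntegrable (fun t => ⟪X' t, X' t⟫ - ⟪R t (X t), X t⟫) volume 0 a :=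
    (hX.intervalIntegrable_inner ha.le hX).sub (hX.intervalIntegrable_inner_clm hR ha.le hX)
  have hbmem : b ∈ Set.uIcc 0 a := by rw [Set.uIcc_of_le ha.le]; exact ⟨hb.le, hba⟩
  have hadd := intervalIntegral.integral_add_adjacent_intervals
    (hint.mono_set (Set.uIcc_subset_uIcc_left hbmem))
    (hint.mono_set (Set.uIcc_subset_uIcc_right hbmem))
  rw [integral_index_eq_add_integral_sq hR hb hba hX hY.hasDerivAt hY.hasDerivAt_deriv hY.isUnit
    fun t ht u v => (hY.column u).inner_deriv_comm (hY.column v) hR hRsym hsym ht] at hadd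
  unfold indexForm
  rw [← hadd]
  ring

theorem index_sub_nonneg (hY : IsJacobiFrame a R V₀ h Y Y') (ha : 0 < a)
    (hR : ContinuousOn R (Set.Icc 0 a))
    (hRsym : ∀ t ∈ Set.Icc 0 a, ∀ x y : EuclideanSpace ℝ (Fin n), ⟪R t x, y⟫ = ⟪x, R t y⟫)
    (hsym : ∀ x ∈ V₀, ∀ y ∈ V₀, h x y = h y x) (hX : IsAdmissibleCurve a T X X')
    (hX0 : X 0 ∈ V₀) :
    0 ≤ indexForm n a R h X X' X X' - ⟪Y' a (frameCoord Y X a), X a⟫ := by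
  obtain ⟨δ, hδ, hsmall⟩ := exists_forall_le_indexForm_nonneg hR h
  set b := min δ a
  have hb : 0 < b := lt_min hδ ha
  have hba : b ≤ a := min_le_right _ _
  have hsub : Set.Icc 0 b ⊆ Set.Icc 0 a := Set.Icc_subset_Icc_right hba
  have hXb := hX.mono hb.le hba
  set K := (hY.mono hba).column (frameCoord Y X b)
  have hKb : K.J b = X b := apply_frameCoord (hY.isUnit b ⟨hb, hba⟩)
  have h1 := hsmall b hb (min_le_left _ _) hba T _ _ (hXb.sub hb.le (K.isAdmissibleCurve hb.le T))
    (by simp [hKb])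
  rw [K.indexForm_sub_eq hb.le (hR.mono hsub) (fun t ht => hRsym t (hsub ht)) hsym hXb hX0 hKb]
    at h1
  rw [hY.index_sub_eq_add_integral_sq hb hba hR hRsym hsym hX]
  exact add_nonneg h1 (intervalIntegral.integral_nonneg hba fun _ _ => sq_nonneg _)

theorem eqOn_column_of_index_sub_eq_zero (hY : IsJacobiFrame a R V₀ h Y Y') (ha : 0 < a)
    (hR : ContinuousOn R (Set.Icc 0 a))
    (hRsym : ∀ t ∈ Set.Icc 0 a, ∀ x y : EuclideanSpace ℝ (Fin n), ⟪R t x, y⟫ = ⟪x, R t y⟫)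
    (hsym : ∀ x ∈ V₀, ∀ y ∈ V₀, h x y = h y x) (hX : IsAdmissibleCurve a T X X')
    (hX0 : X 0 ∈ V₀)
    (heq : indexForm n a R h X X' X X' - ⟪Y' a (frameCoord Y X a), X a⟫ = 0) :
    Set.EqOn X (fun t => Y t (frameCoord Y X a)) (Set.Icc 0 a) := by
  have hcont : ContinuousOn (fun t => Y t (frameCoord Y X a)) (Set.Icc 0 a) :=
    ((hY.column (frameCoord Y X a)).isAdmissibleCurve ha.le ∅).continuousOn
  refine Set.EqOn.of_subset_closure (s := Set.Ioc 0 a) (fun t ht => ?_) hX.continuousOn hcont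
    Set.Ioc_subset_Icc_self (closure_Ioc ha.ne).ge
  have hsplit := hY.index_sub_eq_add_integral_sq ht.1 ht.2 hR hRsym hsym hX
  have hsub : Set.Icc 0 t ⊆ Set.Icc 0 a := Set.Icc_subset_Icc_right ht.2
  have hnonneg := (hY.mono ht.2).index_sub_nonneg ht.1 (hR.mono hsub)
    (fun s hs => hRsym s (hsub hs)) hsym (hX.mono ht.1.le ht.2) hX0
  have hint : 0 ≤ ∫ s in t..a, ‖X' s - Y' s (frameCoord Y X s)‖ ^ 2 :=
    intervalIntegral.integral_nonneg ht.2 fun _ _ => sq_nonneg _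
  have hc := frameCoord_eq_of_integral_sq_eq_zero ht.1 ht.2 hX hY.hasDerivAt
    (HasDerivAt.continuousOn hY.hasDerivAt_deriv) hY.isUnit (by linarith)
  rw [← hc, apply_frameCoord (hY.isUnit t ht)]

end IsJacobiFrame

theorem IsAdmissibleCurve.indexForm_self_congr {Y Y' : ℝ → EuclideanSpace ℝ (Fin n)} (hb : 0 ≤ b)
    (hX : IsAdmissibleCurve b T X X') (hY : IsAdmissibleCurve b T Y Y')
    (hXY : Set.EqOn X Y (Set.Icc 0 b)) :
    indexForm n b R h X X' X X' = indexForm n b R h Y Y' Y Y' := by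
  unfold indexForm
  rw [hXY (Set.left_mem_Icc.2 hb), intervalIntegral.integral_of_le hb,
    intervalIntegral.integral_of_le hb, ← restrict_Ioo_eq_restrict_Ioc]
  congr 1
  refine integral_congr_ae ?_
  filter_upwards [ae_restrict_mem measurableSet_Ioo,
    ae_restrict_of_ae (measure_eq_zero_iff_ae_notMem.1 (T.finite_toSet.measure_zero volume))]
    with t ht hT
  have hderiv : X' t = Y' t := (hX.hasDerivAt t ⟨ht, hT⟩).unique
    ((hY.hasDerivAt t ⟨ht, hT⟩).congr_of_eventuallyEq
      (hXY.eventuallyEq_of_mem (Icc_mem_nhds ht.1 ht.2)))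
  rw [hderiv, hXY (Set.Ioo_subset_Icc_self ht)]

end

/-- Paper's Theorem 3.6 (basic index lemma): if no nontrivial transverse Jacobi solution
vanishes on `(0, a]`, then for every piecewise-`C¹` curve `X` with `X(0) ∈ V₀` there is a
unique transverse Jacobi solution `J` with `J(a) = X(a)`, and `I(X,X) ≥ I(J,J)` with equality
iff `X = J`. -/
theorem index_lemma_of_no_focal_points
    {n : ℕ} {a : ℝ} (ha : 0 < a)
    (R : ℝ → EuclideanSpace ℝ (Fin n) →L[ℝ] EuclideanSpace ℝ (Fin n))
    (hRcont : ContinuousOn R (Set.Icc 0 a))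
    (hRsym : ∀ t ∈ Set.Icc 0 a, ∀ x y : EuclideanSpace ℝ (Fin n), ⟪R t x, y⟫ = ⟪x, R t y⟫)
    (V₀ : Submodule ℝ (EuclideanSpace ℝ (Fin n)))
    (h : EuclideanSpace ℝ (Fin n) →ₗ[ℝ] EuclideanSpace ℝ (Fin n) →ₗ[ℝ] ℝ)
    (hsym : ∀ x ∈ V₀, ∀ y ∈ V₀, h x y = h y x)
    (hfocal : ∀ K : TransverseJacobi n a R V₀ h, ∀ t ∈ Set.Ioc 0 a,
      K.J t = 0 → ∀ s ∈ Set.Icc 0 a, K.J s = 0)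
    (X X' : ℝ → EuclideanSpace ℝ (Fin n)) (T : Finset ℝ)
    (hXcont : ContinuousOn X (Set.Icc 0 a))
    (hXderiv : ∀ t ∈ Set.Icc 0 a \ (T : Set ℝ), HasDerivWithinAt X (X' t) (Set.Icc 0 a) t)
    (hXint : IntervalIntegrable (fun t => ‖X' t‖ ^ 2) volume 0 a)
    (hX0 : X 0 ∈ V₀) :
    ∃ K : TransverseJacobi n a R V₀ h, K.J a = X a ∧
      (∀ K' : TransverseJacobi n a R V₀ h, K'.J a = X a →
        ∀ t ∈ Set.Icc 0 a, K'.J t = K.J t) ∧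
      indexForm n a R h K.J K.J' K.J K.J' ≤ indexForm n a R h X X' X X' ∧
      (indexForm n a R h X X' X X' = indexForm n a R h K.J K.J' K.J K.J' ↔
        ∀ t ∈ Set.Icc 0 a, X t = K.J t) := by
  obtain ⟨Y, Y', hY⟩ := exists_isJacobiFrame ha hRcont hfocal
  have hX : IsAdmissibleCurve a T X X' := ⟨hXcont, fun t ht =>
    (hXderiv t ⟨Set.Ioo_subset_Icc_self ht.1, ht.2⟩).hasDerivAt (Icc_mem_nhds ht.1.1 ht.1.2),
    hXint⟩
  have hKa : Y a (frameCoord Y X a) = X a := apply_frameCoord (hY.isUnit a ⟨ha, le_rfl⟩)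
  set K := hY.column (frameCoord Y X a)
  have hKadm := K.isAdmissibleCurve ha.le T
  have hIK : indexForm n a R h K.J K.J' K.J K.J' = ⟪Y' a (frameCoord Y X a), X a⟫ := by
    rw [K.indexForm_left ha.le hRcont hKadm K.init_mem]
    exact congrArg _ hKa
  refine ⟨K, hKa, fun K' hK' t ht => ?_, ?_, fun heq => ?_, fun heq => ?_⟩
  · exact sub_eq_zero.1 (hfocal (K'.sub K) a ⟨ha, le_rfl⟩
      (sub_eq_zero.2 (hK'.trans hKa.symm)) t ht)
  · rw [hIK]
    exact sub_nonneg.1 (hY.index_sub_nonneg ha hRcont hRsym hsym hX hX0)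
  · exact hY.eqOn_column_of_index_sub_eq_zero ha hRcont hRsym hsym hX hX0
      (sub_eq_zero.2 (heq.trans hIK))
  · exact hX.indexForm_self_congr ha.le hKadm heq
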